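/- Let p and q be money lotteries with supports contained in [a,b] such that p SOSD q and p and q have equal means (Σ_z z·p(z) = Σ_z z·q(z)), and let u : ℝ → ℝ be convex. Then E_q[u] ≥ E_p[u]. -/

import Mathlib

open MeasureTheory

/-- A money lottery: a finitely supported probability mass function on ℝ. -/
structure Lottery where
  pmf : ℝ → ℝ
  nonneg : ∀ z, 0 ≤ pmf z
  finSupp : (Function.support pmf).Finite
  total : ∑ᶠ z, pmf z = 1

/-- Expected utility of a lottery `p` under utility function `u`. -/
noncomputable def EU (p : Lottery) (u : ℝ → ℝ) : ℝ := ∑ᶠ z, p.pmf z * u z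

/-- The mean of a lottery. -/
noncomputable def mean (p : Lottery) : ℝ := ∑ᶠ z, z * p.pmf z

/-- Cumulative distribution function of a lottery. -/
noncomputable def cdf (p : Lottery) (x : ℝ) : ℝ := ∑ᶠ z, if z ≤ x then p.pmf z else 0

/-- `p` second-order stochastically dominates `q`, relative to an interval `[a,b]`
containing both supports. -/
def SOSDon (a b : ℝ) (p q : Lottery) : Prop :=
  Function.support p.pmf ⊆ Set.Icc a b ∧ Function.support q.pmf ⊆ Set.Icc a b ∧
  (∀ x ∈ Set.Icc a b, (∫ t in a..x, (cdf p t - cdf q t)) ≤ 0) ∧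
  (∃ x ∈ Set.Icc a b, (∫ t in a..x, (cdf p t - cdf q t)) < 0)

/-- An affine function agreeing with a convex function at `x < y` lies below it left of `x`. -/
lemma ConvexOn.affine_le_of_eq_of_eq {u : ℝ → ℝ} (hu : ConvexOn ℝ Set.univ u)
    {α β x y z : ℝ} (hx : α + β * x = u x) (hy : α + β * y = u y) (hzx : z ≤ x) (hxy : x < y) :
    α + β * z ≤ u z := by
  rcases hzx.eq_or_lt with rfl | hzx
  · exact hx.le
  · have h := hu.slope_mono_adjacent (Set.mem_univ z) (Set.mem_univ y) hzx hxy
    have h_slope : (u y - u x) / (y - x) = β := by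
      rw [← hx, ← hy, div_eq_iff (sub_pos.2 hxy).ne']
      ring
    rw [h_slope, div_le_iff₀ (sub_pos.2 hzx), ← hx] at h
    linarith

/-- On a finite subset of `[a, b]`, a convex function agrees with a function obtained from an
affine one by adding nonnegative multiples of the hinges `z ↦ max (x - z) 0`. Hence a signed
weight that annihilates affine functions and is nonnegative on hinges is nonnegative on it. -/
lemma ConvexOn.exists_eqOn_finset_sum_nonneg {u : ℝ → ℝ} (hu : ConvexOn ℝ Set.univ u)
    {a b : ℝ} (hab : a ≤ b) (T : Finset ℝ) (w : ℝ → ℝ)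
    (h_total : ∑ z ∈ T, w z = 0) (h_mean : ∑ z ∈ T, w z * z = 0)
    (h_hinge : ∀ x ∈ Set.Icc a b, 0 ≤ ∑ z ∈ T, w z * max (x - z) 0)
    (S : Finset ℝ) (hS : ∀ s ∈ S, s ∈ Set.Icc a b) :
    ∃ g : ℝ → ℝ, ∃ c ∈ Set.Icc a b, ∃ α β : ℝ, 0 ≤ ∑ z ∈ T, w z * g z ∧ (∀ s ∈ S, g s = u s) ∧
      (c = b ∨ c ∈ S) ∧ (∀ s ∈ S, c ≤ s) ∧ g c = u c ∧ (∀ z ≤ c, g z = α + β * z) ∧ ∀ z ≤ c, g z ≤ u z := by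
  induction S using Finset.induction_on_min with
  | empty =>
    refine ⟨fun z => (u b - (u (b + 1) - u b) * b) + (u (b + 1) - u b) * z, b, ⟨hab, le_rfl⟩,
      _, _, ?_, by simp, Or.inl rfl, by simp, by ring, fun z _ => rfl, fun z hz => ?_⟩
    · have h_sum (k l : ℝ) :
          ∑ z ∈ T, w z * (k + l * z) = k * ∑ z ∈ T, w z + l * ∑ z ∈ T, w z * z := by
        rw [Finset.mul_sum, Finset.mul_sum, ← Finset.sum_add_distrib]
        exact Finset.sum_congr rfl fun z _ => by ring
      simp [h_sum, h_total, h_mean]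
    · exact hu.affine_le_of_eq_of_eq (by ring) (by ring) hz (lt_add_one b)
  | insert m S hm ih =>
    obtain ⟨g, c, hc, α, β, hg, hgS, hcS, h_lb, hgc, h_aff, h_le⟩ :=
      ih fun s hs => hS s (Finset.mem_insert_of_mem hs)
    have hm_mem := hS m (Finset.mem_insert_self m S)
    have hmc : m ≤ c := by
      rcases hcS with rfl | hcS
      · exact hm_mem.2
      · exact (hm c hcS).le
    rcases hmc.eq_or_lt with rfl | hmc
    · exact ⟨g, m, hc, α, β, hg, by simpa [hgc] using hgS, by simp, by simpa using h_lb, hgc, h_aff, h_le⟩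
    have hcm : 0 < c - m := sub_pos.2 hmc
    set d := (u m - g m) / (c - m)
    have hd_nonneg : 0 ≤ d := div_nonneg (sub_nonneg.2 (h_le m hmc.le)) hcm.le
    have hdm : d * (c - m) = u m - g m := div_mul_cancel₀ _ hcm.ne'
    have h_left : ∀ z ≤ c, g z + d * max (c - z) 0 = (α + d * c) + (β - d) * z := fun z hz => by
      rw [h_aff z hz, max_eq_left (sub_nonneg.2 hz)]
      ring
    have h_new : g m + d * max (c - m) 0 = u m := by
      rw [max_eq_left hcm.le, hdm]
      ring
    refine ⟨fun z => g z + d * max (c - z) 0, m, hm_mem, α + d * c, β - d, ?_, ?_, by simp,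
      ?_, h_new, fun z hz => h_left z (hz.trans hmc.le), fun z hz => ?_⟩
    · have h_sum : ∑ z ∈ T, w z * (g z + d * max (c - z) 0) =
          ∑ z ∈ T, w z * g z + d * ∑ z ∈ T, w z * max (c - z) 0 := by
        rw [Finset.mul_sum, ← Finset.sum_add_distrib]
        exact Finset.sum_congr rfl fun z _ => by ring
      rw [h_sum]
      exact add_nonneg hg (mul_nonneg hd_nonneg (h_hinge c hc))
    · intro s hs
      rcases Finset.mem_insert.1 hs with rfl | hs
      · exact h_new
      · simp [max_eq_right (sub_nonpos.2 (h_lb s hs)), hgS s hs]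
    · simpa using fun s hs => (hm s hs).le
    · dsimp only
      rw [h_left z (hz.trans hmc.le)]
      refine hu.affine_le_of_eq_of_eq ((h_left m hmc.le).symm.trans h_new) ?_ hz hmc
      rw [← h_left c le_rfl, sub_self, max_self, mul_zero, add_zero, hgc]

lemma integral_ite_le_eq_mul_max {a x z : ℝ} (ha : a ≤ z) (hx : a ≤ x) (r : ℝ) :
    ∫ t in a..x, (if z ≤ t then r else 0) = r * max (x - z) 0 := by
  have h_ind : (fun t => if z ≤ t then r else 0) = (Set.Ici z).indicator fun _ => r := by
    ext t
    simp [Set.indicator]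
  have h_inter : Set.Icc a x ∩ Set.Ici z = Set.Icc z x := by
    ext t
    simp only [Set.mem_inter_iff, Set.mem_Icc, Set.mem_Ici]
    exact ⟨fun h => ⟨h.2, h.1.2⟩, fun h => ⟨⟨ha.trans h.1, h.2⟩, h.1⟩⟩
  rw [intervalIntegral.integral_of_le hx, ← integral_Icc_eq_integral_Ioc, h_ind,
    setIntegral_indicator measurableSet_Ici, h_inter, setIntegral_const, Measure.real,
    Real.volume_Icc, ENNReal.toReal_ofReal', smul_eq_mul, mul_comm]

lemma intervalIntegrable_ite_le (a x z r : ℝ) :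
    IntervalIntegrable (fun t => if z ≤ t then r else 0) volume a x := by
  have h_mono : Monotone fun t : ℝ => if z ≤ t then (1 : ℝ) else 0 := fun s t hst => by
    dsimp only
    split_ifs <;> linarith
  simpa using h_mono.intervalIntegrable.const_mul (μ := volume) (a := a) (b := x) r

namespace Lottery

variable (p : Lottery) {T : Finset ℝ}

lemma finsum_eq_sum_of_subset (hT : Function.support p.pmf ⊆ T) {f : ℝ → ℝ}
    (hf : ∀ z, p.pmf z = 0 → f z = 0) : ∑ᶠ z, f z = ∑ z ∈ T, f z :=
  finsum_eq_sum_of_support_subset f fun z hz => hT fun h => hz (hf z h)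

lemma sum_pmf (hT : Function.support p.pmf ⊆ T) : ∑ z ∈ T, p.pmf z = 1 :=
  (p.finsum_eq_sum_of_subset hT fun _ h => h).symm.trans p.total

lemma mean_eq_sum (hT : Function.support p.pmf ⊆ T) : mean p = ∑ z ∈ T, p.pmf z * z := by
  simp only [mean, mul_comm (_ : ℝ) (p.pmf _)]
  exact p.finsum_eq_sum_of_subset hT fun z h => by simp [h]

lemma eu_eq_sum (hT : Function.support p.pmf ⊆ T) (u : ℝ → ℝ) :
    EU p u = ∑ z ∈ T, p.pmf z * u z :=
  p.finsum_eq_sum_of_subset hT fun z h => by simp [h]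

lemma cdf_eq_sum (hT : Function.support p.pmf ⊆ T) :
    cdf p = fun x => ∑ z ∈ T, if z ≤ x then p.pmf z else 0 :=
  funext fun _ => p.finsum_eq_sum_of_subset hT fun z h => by simp [h]

lemma intervalIntegrable_cdf (a x : ℝ) : IntervalIntegrable (cdf p) volume a x := by
  rw [p.cdf_eq_sum (T := p.finSupp.toFinset) (by simp)]
  simpa only [Finset.sum_fn] using
    IntervalIntegrable.sum _ fun z _ => intervalIntegrable_ite_le a x z (p.pmf z)

lemma integral_cdf (hT : Function.support p.pmf ⊆ T) {a x : ℝ} (ha : ∀ z ∈ T, a ≤ z)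
    (hx : a ≤ x) : ∫ t in a..x, cdf p t = ∑ z ∈ T, p.pmf z * max (x - z) 0 := by
  rw [p.cdf_eq_sum hT, intervalIntegral.integral_finsetSum fun z _ =>
    intervalIntegrable_ite_le a x z (p.pmf z)]
  exact Finset.sum_congr rfl fun z hz => integral_ite_le_eq_mul_max (ha z hz) hx _

end Lottery

/-- If `p` SOSD `q` with equal means (so `q` is a mean-preserving spread of `p`)
and `u` is convex, then `E_q[u] ≥ E_p[u]`. -/
theorem eu_le_of_sosd_equal_means_of_convex
    (a b : ℝ) (p q : Lottery)
    (hp : Function.support p.pmf ⊆ Set.Icc a b)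
    (hq : Function.support q.pmf ⊆ Set.Icc a b)
    (hsosd : SOSDon a b p q)
    (hmeans : mean p = mean q)
    (u : ℝ → ℝ) (hconv : ConvexOn ℝ Set.univ u) :
    EU p u ≤ EU q u := by
  obtain ⟨-, -, h_int, x₀, hx₀, -⟩ := hsosd
  set T := p.finSupp.toFinset ∪ q.finSupp.toFinset with hT
  have hpT : Function.support p.pmf ⊆ T := by simp [hT]
  have hqT : Function.support q.pmf ⊆ T := by simp [hT]
  have hTab : ∀ z ∈ T, z ∈ Set.Icc a b := fun z hz => by
    rcases Finset.mem_union.1 hz with h | h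
    · exact hp (p.finSupp.mem_toFinset.1 h)
    · exact hq (q.finSupp.mem_toFinset.1 h)
  have h_diff : ∀ f : ℝ → ℝ, ∑ z ∈ T, (q.pmf z - p.pmf z) * f z =
      ∑ z ∈ T, q.pmf z * f z - ∑ z ∈ T, p.pmf z * f z := fun f => by
    simp only [sub_mul, Finset.sum_sub_distrib]
  obtain ⟨g, -, -, -, -, hg, hgu, -⟩ := hconv.exists_eqOn_finset_sum_nonneg
    (hx₀.1.trans hx₀.2) T (fun z => q.pmf z - p.pmf z)
    (by rw [Finset.sum_sub_distrib, q.sum_pmf hqT, p.sum_pmf hpT, sub_self])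
    (by rw [h_diff fun z => z, ← q.mean_eq_sum hqT, ← p.mean_eq_sum hpT, hmeans, sub_self])
    (fun x hx => by
      have h := h_int x hx
      rw [intervalIntegral.integral_sub (p.intervalIntegrable_cdf a x)
        (q.intervalIntegrable_cdf a x), p.integral_cdf hpT (fun z hz => (hTab z hz).1) hx.1,
        q.integral_cdf hqT (fun z hz => (hTab z hz).1) hx.1] at h
      rw [h_diff fun z => max (x - z) 0]
      linarith)
    T hTab
  rw [Finset.sum_congr rfl fun z hz => by rw [hgu z hz], h_diff u] at hg
  rw [p.eu_eq_sum hpT, q.eu_eq_sum hqT]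
  exact sub_nonneg.1 hg
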